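/- Let a, b ≥ 2 be integers, set m = ab, and let Ω be the set of all partitions of {1,…,m} into a parts each of size b, so that |Ω| = m!/((b!)^a · a!). Let f(a,b) denote the minimal base size of the symmetric group Sym(m) acting on Ω. Then f(a,b) ≤ ln(m!) / ln|Ω| + 5. -/

import Mathlib

open Pointwise

/-- The cardinalities of the bases for `Sym(ab)` acting on the partitions of `{1,…,ab}` into `a`
parts of size `b`. -/
def partitionBaseCards (a b : ℕ) : Set ℕ :=
  {c : ℕ | ∃ B : Finset (Finset (Finset (Fin (a * b)))), B.card = c ∧
        (∀ P ∈ B, P.card = a ∧ (∀ s ∈ P, s.card = b) ∧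
          (∀ x : Fin (a * b), ∃ s ∈ P, x ∈ s) ∧
          (∀ s ∈ P, ∀ t ∈ P, s ≠ t → Disjoint s t)) ∧
        ∀ g : Equiv.Perm (Fin (a * b)), (∀ P ∈ B, g • P = P) → g = 1}

/-- The partition of a finite type into the fibres of a function. -/
def fiberPartition {Y K : Type*} [Fintype Y] [DecidableEq Y] [Fintype K] [DecidableEq K]
    (f : Y → K) : Finset (Finset Y) :=
  Finset.univ.image fun z => Finset.univ.filter fun y => f y = z

theorem eq_of_smul_fiberPartition {Y K : Type*} [Fintype Y] [DecidableEq Y] [Fintype K]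
    [DecidableEq K] {f : Y → K} {g : Equiv.Perm Y}
    (hg : g • fiberPartition f = fiberPartition f) {p q : Y} (h : f p = f q) :
    f (g p) = f (g q) := by
  have hs : (Finset.univ.filter fun y => f y = f q) ∈ fiberPartition f :=
    Finset.mem_image_of_mem _ (Finset.mem_univ _)
  have hs' := Finset.smul_mem_smul_finset (a := g) hs
  rw [hg] at hs'
  obtain ⟨z, -, hz⟩ := Finset.mem_image.1 hs'
  have hp : g • p ∈ g • (Finset.univ.filter fun y => f y = f q) :=
    Finset.smul_mem_smul_finset (by simpa using h)
  have hq : g • q ∈ g • (Finset.univ.filter fun y => f y = f q) :=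
    Finset.smul_mem_smul_finset (by simp)
  rw [← hz] at hp hq
  simp only [Finset.mem_filter, Finset.mem_univ, true_and, Equiv.Perm.smul_def] at hp hq
  rw [hp, hq]

theorem eq_iff_of_smul_fiberPartition {Y K : Type*} [Fintype Y] [DecidableEq Y] [Fintype K]
    [DecidableEq K] {f : Y → K} {g : Equiv.Perm Y}
    (hg : g • fiberPartition f = fiberPartition f) (p q : Y) :
    f p = f q ↔ f (g p) = f (g q) := by
  refine ⟨eq_of_smul_fiberPartition hg, fun h => ?_⟩
  have hg' : g⁻¹ • fiberPartition f = fiberPartition f := by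
    rw [inv_smul_eq_iff, hg]
  simpa using eq_of_smul_fiberPartition hg' h

/-- A family of balanced colourings with no common nontrivial symmetry gives a base. -/
theorem sInf_partitionBaseCards_le {a b : ℕ} (hb : 0 < b) {X K ι : Type*} [Fintype X]
    [Fintype K] [DecidableEq K] [Fintype ι] (hK : Fintype.card K = a)
    (hX : Fintype.card X = a * b) (F : ι → X → K)
    (hF : ∀ i z, (Finset.univ.filter fun x => F i x = z).card = b)
    (hg : ∀ g : Equiv.Perm X, (∀ i p q, F i p = F i q ↔ F i (g p) = F i (g q)) → g = 1) :
    sInf (partitionBaseCards a b) ≤ Fintype.card ι := by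
  classical
  let e : X ≃ Fin (a * b) := Fintype.equivFinOfCardEq hX
  let B : Finset (Finset (Finset (Fin (a * b)))) :=
    Finset.univ.image fun i => fiberPartition (F i ∘ e.symm)
  have hfib : ∀ i z, (Finset.univ.filter fun y => (F i ∘ e.symm) y = z).card = b := by
    intro i z
    refine Eq.trans ?_ (hF i z)
    refine Finset.card_bij' (fun y _ => e.symm y) (fun x _ => e x) ?_ ?_ ?_ ?_ <;> simp
  suffices h : B.card ∈ partitionBaseCards a b from
    (Nat.sInf_le h).trans Finset.card_image_le
  refine ⟨B, rfl, ?_, ?_⟩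
  · intro P hP
    obtain ⟨i, -, rfl⟩ := Finset.mem_image.1 hP
    refine ⟨?_, ?_, ?_, ?_⟩
    · unfold fiberPartition
      rw [Finset.card_image_of_injective, Finset.card_univ, hK]
      intro z w hzw
      have hne : (Finset.univ.filter fun y => (F i ∘ e.symm) y = z).Nonempty := by
        rw [← Finset.card_pos, hfib]; exact hb
      obtain ⟨y, hy⟩ := hne
      have hy' := hy
      dsimp only at hzw
      rw [hzw] at hy'
      exact (Finset.mem_filter.1 hy).2.symm.trans (Finset.mem_filter.1 hy').2
    · intro s hs
      obtain ⟨z, -, rfl⟩ := Finset.mem_image.1 hs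
      exact hfib i z
    · intro x
      exact ⟨_, Finset.mem_image_of_mem _ (Finset.mem_univ ((F i ∘ e.symm) x)), by simp⟩
    · intro s hs t ht hst
      obtain ⟨z, -, rfl⟩ := Finset.mem_image.1 hs
      obtain ⟨w, -, rfl⟩ := Finset.mem_image.1 ht
      refine Finset.disjoint_filter.2 fun y _ h1 h2 => hst ?_
      rw [← h1, ← h2]
  · intro g hgP
    have h1 : (e.trans g).trans e.symm = (1 : Equiv.Perm X) := by
      refine hg _ fun i p q => ?_
      simpa using eq_iff_of_smul_fiberPartition
        (hgP _ (Finset.mem_image_of_mem _ (Finset.mem_univ i))) (e p) (e q)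
    ext y
    have := Equiv.congr_fun h1 (e.symm y)
    simp only [Equiv.trans_apply, Equiv.apply_symm_apply, Equiv.Perm.one_apply,
      EmbeddingLike.apply_eq_iff_eq] at this
    simp [this]

theorem card_fiber_add {A Y : Type*} [AddGroup A] [Fintype A] [DecidableEq A] [Fintype Y]
    (h : Y → A) (z : A) :
    (Finset.univ.filter fun p : A × Y => p.1 + h p.2 = z).card = Fintype.card Y := by
  rw [← Finset.card_univ]
  refine Finset.card_bij' (fun p _ => p.2) (fun y _ => (z - h y, y)) ?_ ?_ ?_ ?_
  · simp
  · simp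
  · rintro ⟨x, y⟩ hp
    simp only [Finset.mem_filter, Finset.mem_univ, true_and] at hp
    simp [← hp]
  · simp

theorem card_fiber_comp_perm {X K : Type*} [Fintype X] [DecidableEq K] (f : X → K)
    (σ : Equiv.Perm X) (z : K) :
    (Finset.univ.filter fun p => f (σ p) = z).card =
      (Finset.univ.filter fun p => f p = z).card := by
  refine Finset.card_bij' (fun p _ => σ p) (fun p _ => σ.symm p) ?_ ?_ ?_ ?_ <;> simp

theorem card_fiber_fst {A Y : Type*} [AddGroup A] [Fintype A] [DecidableEq A] [Fintype Y]
    (z : A) :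
    (Finset.univ.filter fun p : A × Y => p.1 = z).card = Fintype.card Y := by
  simpa using card_fiber_add (fun _ : Y => (0 : A)) z

theorem ZMod.forall_of_add_one {a : ℕ} [NeZero a] {p : ZMod a → Prop} (h0 : p 0)
    (h1 : ∀ x, p x → p (x + 1)) (x : ZMod a) : p x := by
  rw [← ZMod.natCast_zmod_val x]
  induction x.val with
  | zero => simpa using h0
  | succ n ih => simpa using h1 _ ih

/-- Colourings of `ZMod a × Fin (n + 3)` whose fibre partitions form a base. -/
def baseColoring {a n : ℕ} {κ : Type*} (d : Fin (n + 3) → κ → ZMod a) :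
    Fin 3 ⊕ κ → ZMod a × Fin (n + 3) → ZMod a
  | .inl 0 => fun p => p.1
  | .inl 1 => fun p => p.1 + if p.2 = 0 then 1 else 0
  | .inl 2 => fun p => (Equiv.swap ((1 : ZMod a), (0 : Fin (n + 3))) (0, 2) p).1
  | .inr i => fun p => p.1 + d p.2 i

theorem card_fiber_baseColoring {a n : ℕ} [NeZero a] {κ : Type*}
    (d : Fin (n + 3) → κ → ZMod a) (i : Fin 3 ⊕ κ) (z : ZMod a) :
    (Finset.univ.filter fun p => baseColoring d i p = z).card = n + 3 := by
  match i with
  | .inl 0 => exact (card_fiber_fst (Y := Fin (n + 3)) z).trans (by simp)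
  | .inl 1 =>
    exact (card_fiber_add (fun y : Fin (n + 3) => if y = 0 then (1 : ZMod a) else 0) z).trans
      (by simp)
  | .inl 2 =>
    refine (card_fiber_comp_perm Prod.fst (Equiv.swap ((1 : ZMod a), (0 : Fin (n + 3))) (0, 2))
      z).trans ?_
    simpa using card_fiber_fst (Y := Fin (n + 3)) z
  | .inr i => exact (card_fiber_add (fun y : Fin (n + 3) => d y i) z).trans (by simp)

theorem eq_one_of_baseColoring {a n : ℕ} (ha : 2 ≤ a) {κ : Type*}
    {d : Fin (n + 3) → κ → ZMod a} (hd : Function.Injective d)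
    (g : Equiv.Perm (ZMod a × Fin (n + 3)))
    (hg : ∀ i p q, baseColoring d i p = baseColoring d i q ↔
      baseColoring d i (g p) = baseColoring d i (g q)) : g = 1 := by
  have : NeZero a := ⟨by omega⟩
  have : Fact (1 < a) := ⟨by omega⟩
  have h0 : ∀ p q : ZMod a × Fin (n + 3), p.1 = q.1 ↔ (g p).1 = (g q).1 := hg (.inl 0)
  have h1 : ∀ p q : ZMod a × Fin (n + 3), (p.1 + if p.2 = 0 then 1 else 0) =
      (q.1 + if q.2 = 0 then 1 else 0) ↔ ((g p).1 + if (g p).2 = 0 then 1 else 0) =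
      ((g q).1 + if (g q).2 = 0 then 1 else 0) := hg (.inl 1)
  have h2 := hg (.inl 2)
  have h3 : ∀ i (p q : ZMod a × Fin (n + 3)), p.1 + d p.2 i = q.1 + d q.2 i ↔
      (g p).1 + d (g p).2 i = (g q).1 + d (g q).2 i := fun i => hg (.inr i)
  have h10 : (1 : ZMod a) ≠ 0 := one_ne_zero
  have f10 : (1 : Fin (n + 3)) ≠ 0 := by simp
  have f20 : (2 : Fin (n + 3)) ≠ 0 := by
    rw [Ne, Fin.ext_iff, Fin.val_two, Fin.val_zero]; omega
  have f12 : (1 : Fin (n + 3)) ≠ 2 := by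
    rw [Ne, Fin.ext_iff, Fin.val_two, Fin.val_one]; omega
  have hcol : ∀ x, (g (x, 0)).2 = 0 := by
    intro x
    by_contra hv
    obtain ⟨v, hv0, hvne⟩ : ∃ v : Fin (n + 3), v ≠ 0 ∧ v ≠ (g (x, 0)).2 := by
      by_cases h : (g (x, 0)).2 = 1
      · exact ⟨2, f20, by rw [h]; exact f12.symm⟩
      · exact ⟨1, f10, fun h' => h h'.symm⟩
    obtain ⟨⟨x', y'⟩, hr⟩ := g.surjective ((g (x, 0)).1, v)
    have e0 := (h0 (x', y') (x, 0)).2 (by rw [hr])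
    have e1 := (h1 (x', y') (x, 0)).2 (by rw [hr]; simp [hv0, hv])
    dsimp only at e0 e1
    subst e0
    have hy : y' = 0 := by
      by_contra hy
      simp [hy] at e1
    subst hy
    exact hvne (by rw [hr])
  have hcol' : ∀ x y, y ≠ 0 → (g (x, y)).2 ≠ 0 := by
    intro x y hy h
    have : g (x, y) = g (x, 0) :=
      Prod.ext ((h0 (x, y) (x, 0)).1 rfl) (h.trans (hcol x).symm)
    exact hy (congrArg Prod.snd (g.injective this))
  have hrot : ∀ x, (g (x, 0)).1 = x + (g (0, 0)).1 := by
    apply ZMod.forall_of_add_one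
    · simp
    · intro x hx
      have e1 := (h1 (x + 1, 1) (x, 0)).1 (by simp)
      rw [if_neg (hcol' _ _ f10), if_pos (hcol x), hx, add_zero,
        (h0 (x + 1, 1) (x + 1, 0)).1 rfl] at e1
      rw [e1]; ring
  obtain ⟨c, hc⟩ : ∃ c, (g (0, 0)).1 = c := ⟨_, rfl⟩
  rw [hc] at hrot
  have hall : ∀ x y, g (x, y) = (x + c, y) := by
    intro x y
    have hfst : (g (x, y)).1 = x + c := ((h0 (x, y) (x, 0)).1 rfl).trans (hrot x)
    refine Prod.ext hfst (hd (funext fun i => ?_))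
    have e3 := (h3 i (x, y) (x + d y i - d 0 i, 0)).1 (by simp)
    rw [hfst, hrot, hcol] at e3
    linear_combination e3
  have hc0 : c = 0 := by
    by_contra hc0
    have e1 := (h2 (0, 0) (1, 0)).1 (by
      simp [baseColoring, Equiv.swap_apply_def, h10.symm, f20.symm])
    have e2 := (h2 (0, 0) (0, 1)).1 (by
      simp [baseColoring, Equiv.swap_apply_def, h10.symm, f20.symm, f10, f12])
    rw [hall, hall] at e1 e2
    simp [baseColoring, Equiv.swap_apply_def, f20.symm, f10, f12, hc0] at e1 e2
    by_cases hc1 : c = 1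
    · simp [hc1] at e2
    · simp [hc1] at e1
  ext1 ⟨x, y⟩
  simp [hall, hc0]

theorem sInf_partitionBaseCards_le_clog {a b : ℕ} (ha : 2 ≤ a) (hb : 3 ≤ b) :
    sInf (partitionBaseCards a b) ≤ Nat.clog a b + 3 := by
  have : NeZero a := ⟨by omega⟩
  obtain ⟨n, rfl⟩ : ∃ n, b = n + 3 := ⟨b - 3, by omega⟩
  have hle : Fintype.card (Fin (n + 3)) ≤
      Fintype.card (Fin (Nat.clog a (n + 3)) → ZMod a) := by
    simpa [ZMod.card] using Nat.le_pow_clog (by omega) (n + 3)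
  obtain ⟨d⟩ := Function.Embedding.nonempty_of_card_le hle
  refine (sInf_partitionBaseCards_le (by omega) (ZMod.card a) (by simp [ZMod.card])
    (baseColoring d) (card_fiber_baseColoring d)
    (eq_one_of_baseColoring ha d.injective)).trans ?_
  simp [add_comm]

/-- Colourings of `ZMod a × Fin 2` whose fibre partitions form a base. -/
def matchingColoring (a : ℕ) : Fin 4 → ZMod a × Fin 2 → ZMod a
  | 0 => fun p => p.1
  | 1 => fun p => p.1 + if p.2 = 0 then 1 else 0
  | 2 => fun p => (Equiv.swap ((1 : ZMod a), (0 : Fin 2)) (0, 1) p).1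
  | 3 => fun p => (Equiv.swap ((2 : ZMod a), (0 : Fin 2)) (1, 1) p).1

theorem card_fiber_matchingColoring {a : ℕ} [NeZero a] (i : Fin 4) (z : ZMod a) :
    (Finset.univ.filter fun p => matchingColoring a i p = z).card = 2 := by
  match i with
  | 0 => exact (card_fiber_fst (Y := Fin 2) z).trans (by simp)
  | 1 =>
    exact (card_fiber_add (fun y : Fin 2 => if y = 0 then (1 : ZMod a) else 0) z).trans (by simp)
  | 2 =>
    refine (card_fiber_comp_perm Prod.fst (Equiv.swap ((1 : ZMod a), (0 : Fin 2)) (0, 1))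
      z).trans ?_
    simpa using card_fiber_fst (Y := Fin 2) z
  | 3 =>
    refine (card_fiber_comp_perm Prod.fst (Equiv.swap ((2 : ZMod a), (0 : Fin 2)) (1, 1))
      z).trans ?_
    simpa using card_fiber_fst (Y := Fin 2) z

theorem eq_one_of_matchingColoring {a : ℕ} (ha : 3 ≤ a) (g : Equiv.Perm (ZMod a × Fin 2))
    (hg : ∀ i p q, matchingColoring a i p = matchingColoring a i q ↔
      matchingColoring a i (g p) = matchingColoring a i (g q)) : g = 1 := by
  have : NeZero a := ⟨by omega⟩
  have : Fact (1 < a) := ⟨by omega⟩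
  have h0 : ∀ p q : ZMod a × Fin 2, p.1 = q.1 ↔ (g p).1 = (g q).1 := hg 0
  have h1 : ∀ p q : ZMod a × Fin 2, (p.1 + if p.2 = 0 then 1 else 0) =
      (q.1 + if q.2 = 0 then 1 else 0) ↔ ((g p).1 + if (g p).2 = 0 then 1 else 0) =
      ((g q).1 + if (g q).2 = 0 then 1 else 0) := hg 1
  have h2 := hg 2
  have h3 := hg 3
  have h10 : (1 : ZMod a) ≠ 0 := one_ne_zero
  have h20 : (2 : ZMod a) ≠ 0 := by
    intro h
    have := (ZMod.natCast_eq_zero_iff 2 a).1 (by exact_mod_cast h)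
    exact absurd (Nat.le_of_dvd (by norm_num) this) (by omega)
  have hfin : ∀ u v : Fin 2, u ≠ v → u = 0 ∧ v = 1 ∨ u = 1 ∧ v = 0 := by decide
  have hrow : ∀ x, (g (x, 1)).1 = (g (x, 0)).1 := fun x => (h0 (x, 1) (x, 0)).1 rfl
  have hside : ∀ x, (g (x, 0)).2 = 0 ∧ (g (x, 1)).2 = 1 ∨
      (g (x, 0)).2 = 1 ∧ (g (x, 1)).2 = 0 := by
    intro x
    refine hfin _ _ fun h => ?_
    have := g.injective (Prod.ext (hrow x).symm h)
    simp at this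
  have hstep : ∀ x, ((g (x, 0)).1 + if (g (x, 0)).2 = 0 then 1 else 0) =
      ((g (x + 1, 1)).1 + if (g (x + 1, 1)).2 = 0 then 1 else 0) :=
    fun x => (h1 (x, 0) (x + 1, 1)).1 (by simp)
  have hcross : ∀ x, (g (x, 0)).2 ≠ (g (x + 1, 1)).2 := by
    intro x h
    have e := hstep x
    rw [h] at e
    have := g.injective (Prod.ext (add_right_cancel e) h)
    simp at this
  obtain ⟨c, hc⟩ : ∃ c, (g (0, 0)).1 = c := ⟨_, rfl⟩
  rcases hside 0 with hs | hs
  · have hrot : ∀ x, g (x, 0) = (x + c, 0) ∧ g (x, 1) = (x + c, 1) := by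
      apply ZMod.forall_of_add_one
      · exact ⟨Prod.ext (by simp [hc]) hs.1, Prod.ext (by simp [hrow, hc]) hs.2⟩
      · rintro x ⟨hx, -⟩
        have e := hstep x
        have e' := hcross x
        rcases hside (x + 1) with ht | ht
        · rw [hx, ht.2, hrow] at e
          simp at e
          exact ⟨Prod.ext (by simp only; rw [← e]; ring) ht.1,
            Prod.ext (by simp only; rw [hrow, ← e]; ring) ht.2⟩
        · rw [hx, ht.2] at e'
          simp at e'
    have hc0 : c = 0 := by
      by_contra hc0
      have e1 := (h2 (0, 0) (1, 0)).1 (by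
        simp [matchingColoring, Equiv.swap_apply_def, h10.symm])
      rw [(hrot _).1, (hrot _).1] at e1
      simp [matchingColoring, Equiv.swap_apply_def, hc0] at e1
      by_cases hc1 : c = 1
      · subst hc1
        simp at e1
        exact h20 (by linear_combination -e1)
      · simp [hc1] at e1
    subst hc0
    ext1 ⟨x, y⟩
    fin_cases y
    · simpa using (hrot x).1
    · simpa using (hrot x).2
  · exfalso
    have hrot : ∀ x, g (x, 0) = (c - x, 1) ∧ g (x, 1) = (c - x, 0) := by
      apply ZMod.forall_of_add_one
      · exact ⟨Prod.ext (by simp [hc]) hs.1, Prod.ext (by simp [hrow, hc]) hs.2⟩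
      · rintro x ⟨hx, -⟩
        have e := hstep x
        have e' := hcross x
        rcases hside (x + 1) with ht | ht
        · rw [hx, ht.2] at e'
          simp at e'
        · rw [hx, ht.2, hrow] at e
          simp at e
          exact ⟨Prod.ext (by simp only; linear_combination -e) ht.1,
            Prod.ext (by simp only; rw [hrow]; linear_combination -e) ht.2⟩
    have hc1 : c = 1 := by
      by_contra hc1
      have e1 := (h2 (0, 0) (1, 0)).1 (by
        simp [matchingColoring, Equiv.swap_apply_def, h10.symm])
      rw [(hrot _).1, (hrot _).1] at e1
      simp [matchingColoring, Equiv.swap_apply_def] at e1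
      by_cases hc0 : c = 0
      · subst hc0
        simp at e1
        exact h20 (by linear_combination e1)
      · simp [hc0, sub_eq_zero, hc1] at e1
        exact h10 (by linear_combination e1)
    subst hc1
    have h12 : (1 : ZMod a) ≠ 2 := fun h => h10 (by linear_combination -h)
    have e2 := (h3 (1, 0) (2, 0)).1 (by
      simp [matchingColoring, Equiv.swap_apply_def, h12])
    rw [(hrot _).1, (hrot _).1] at e2
    have h121 : (1 : ZMod a) - 2 ≠ 1 := fun h => h20 (by linear_combination -h)
    simp [matchingColoring, Equiv.swap_apply_def, h10.symm, h121] at e2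
    exact h10 (by linear_combination e2)

theorem sInf_partitionBaseCards_two_le {a : ℕ} (ha : 3 ≤ a) :
    sInf (partitionBaseCards a 2) ≤ 4 := by
  have : NeZero a := ⟨by omega⟩
  simpa using sInf_partitionBaseCards_le (by omega) (ZMod.card a) (by simp [ZMod.card])
    (matchingColoring a) card_fiber_matchingColoring (eq_one_of_matchingColoring ha)

theorem partitionBaseCards_two_two : partitionBaseCards 2 2 = ∅ := by
  have hfix : ∀ s t : Finset (Fin (2 * 2)), s.card = 2 → t.card = 2 → s ∩ t = ∅ →
      (Equiv.swap (0 : Fin (2 * 2)) 1 * Equiv.swap 2 3) • ({s, t} : Finset (Finset _)) =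
        {s, t} := by
    decide +kernel
  refine Set.eq_empty_of_forall_notMem ?_
  rintro c ⟨B, -, hB, hg⟩
  have h := hg (Equiv.swap 0 1 * Equiv.swap 2 3) fun P hP => by
    obtain ⟨h1, h2, -, h4⟩ := hB P hP
    obtain ⟨s, t, hst, rfl⟩ := Finset.card_eq_two.1 h1
    exact hfix s t (h2 s (by simp)) (h2 t (by simp))
      (Finset.disjoint_iff_inter_eq_empty.1 (h4 s (by simp) t (by simp) hst))
  exact absurd (Equiv.congr_fun h 0) (by decide)

theorem factorial_div_eq_uniformBell {a b : ℕ} (hb : b ≠ 0) :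
    ((a * b).factorial : ℝ) / ((b.factorial : ℝ) ^ a * a.factorial) = Nat.uniformBell a b := by
  rw [div_eq_iff (by positivity), ← Nat.uniformBell_mul_eq a hb]
  push_cast
  ring

theorem one_lt_uniformBell {a b : ℕ} (ha : 2 ≤ a) (hb : 2 ≤ b) : 1 < Nat.uniformBell a b := by
  rw [Nat.uniformBell_eq]
  have hpos : ∀ p, 1 ≤ (p * b + b - 1).choose (b - 1) := fun p =>
    Nat.choose_pos (by have := Nat.zero_le (p * b); omega)
  calc 1 < (1 * b + b - 1).choose (b - 1) := by
        have h := Nat.choose_le_choose (b - 1) (show b ≤ 1 * b + b - 1 by omega)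
        rw [Nat.choose_symm (by omega), Nat.choose_one_right] at h
        omega
    _ ≤ _ := Finset.single_le_prod' (f := fun p => (p * b + b - 1).choose (b - 1))
        (fun p _ => hpos p) (Finset.mem_range.2 (by omega : 1 < a))

theorem uniformBell_le_pow (a : ℕ) {b : ℕ} (hb : b ≠ 0) :
    Nat.uniformBell a b ≤ a ^ (a * b) := by
  have hmult : Nat.multinomial Finset.univ (fun _ : Fin a => b) ≤ a ^ (a * b) := by
    have h := Finset.sum_pow_eq_sum_piAntidiag (Finset.univ : Finset (Fin a))
      (fun _ => (1 : ℕ)) (a * b)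
    simp only [Finset.sum_const, Finset.card_univ, Fintype.card_fin, smul_eq_mul, mul_one,
      one_pow, Finset.prod_const_one, Nat.cast_id] at h
    rw [h]
    exact Finset.single_le_sum (f := fun k => Nat.multinomial Finset.univ k)
      (fun _ _ => Nat.zero_le _) (by simp)
  refine le_trans ?_ hmult
  have h1 := Nat.multinomial_spec Finset.univ (fun _ : Fin a => b)
  simp only [Finset.prod_const, Finset.sum_const, Finset.card_univ, Fintype.card_fin,
    smul_eq_mul] at h1
  rw [← Nat.uniformBell_mul_eq a hb] at h1
  refine Nat.le_of_mul_le_mul_left ?_ (pow_pos b.factorial_pos a)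
  rw [h1]
  nlinarith [Nat.mul_le_mul_left (Nat.uniformBell a b * b.factorial ^ a) a.factorial_pos]

theorem le_log_factorial_div_log_uniformBell {a b k : ℕ} (ha : 2 ≤ a) (hb : 2 ≤ b)
    (hk : a ^ (k + 1) ≤ b) :
    (k : ℝ) ≤ Real.log ((a * b).factorial) / Real.log (Nat.uniformBell a b) := by
  have hU : (1 : ℝ) < Nat.uniformBell a b := by exact_mod_cast one_lt_uniformBell ha hb
  rw [le_div_iff₀ (Real.log_pos hU), ← Real.log_pow]
  refine Real.log_le_log (by positivity) ?_
  set m := a * b with hm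
  have hm0 : 0 < m := by positivity
  have h4 : 4 * a ^ k ≤ m := by
    calc 4 * a ^ k ≤ a * a * a ^ k := by gcongr; nlinarith
      _ = a * a ^ (k + 1) := by ring
      _ ≤ m := by rw [hm]; gcongr
  have h4' : (4 : ℝ) * a ^ k ≤ m := by exact_mod_cast h4
  have hexp : Real.exp 1 ^ m ≤ 4 ^ m :=
    pow_le_pow_left₀ (Real.exp_pos 1).le (by linarith [Real.exp_one_lt_d9]) m
  have hfac := Real.pow_div_factorial_le_exp (m : ℝ) (by positivity) m
  rw [div_le_iff₀ (by positivity), ← Real.exp_one_pow] at hfac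
  have hB : (Nat.uniformBell a b : ℝ) ≤ a ^ m := by
    exact_mod_cast uniformBell_le_pow a (by omega : b ≠ 0)
  have h5 : (4 : ℝ) ^ m * (a ^ k) ^ m ≤ 4 ^ m * m.factorial := by
    rw [← mul_pow]
    calc ((4 : ℝ) * a ^ k) ^ m ≤ m ^ m := pow_le_pow_left₀ (by positivity) h4' m
      _ ≤ _ := hfac
      _ ≤ _ := by gcongr
  calc (Nat.uniformBell a b : ℝ) ^ k ≤ ((a : ℝ) ^ m) ^ k := by gcongr
    _ = (a ^ k) ^ m := by rw [← pow_mul, ← pow_mul, mul_comm]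
    _ ≤ m.factorial := le_of_mul_le_mul_left h5 (by positivity)

/-- Let `a, b ≥ 2`, `m = ab`, and let `Ω` be the set of partitions of
`{1,…,m}` into `a` parts of size `b`, so `|Ω| = m!/((b!)^a a!)`. The minimal base size
`f(a,b)` of `Sym(m)` acting on `Ω` satisfies `f(a,b) ≤ ln(m!)/ln|Ω| + 5`. -/
theorem base_size_partitions_le (a b : ℕ) (ha : 2 ≤ a) (hb : 2 ≤ b) :
    ((sInf {c : ℕ | ∃ B : Finset (Finset (Finset (Fin (a * b)))), B.card = c ∧
        (∀ P ∈ B, P.card = a ∧ (∀ s ∈ P, s.card = b) ∧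
          (∀ x : Fin (a * b), ∃ s ∈ P, x ∈ s) ∧
          (∀ s ∈ P, ∀ t ∈ P, s ≠ t → Disjoint s t)) ∧
        ∀ g : Equiv.Perm (Fin (a * b)), (∀ P ∈ B, g • P = P) → g = 1} : ℕ) : ℝ) ≤
      Real.log ((a * b).factorial) /
        Real.log (((a * b).factorial : ℝ) / ((b.factorial : ℝ) ^ a * a.factorial)) + 5 := by
  change ((sInf (partitionBaseCards a b) : ℕ) : ℝ) ≤ _
  rw [factorial_div_eq_uniformBell (by omega)]
  have hnonneg : 0 ≤ Real.log ((a * b).factorial) / Real.log (Nat.uniformBell a b) :=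
    div_nonneg (Real.log_natCast_nonneg _) (Real.log_natCast_nonneg _)
  have hsmall : sInf (partitionBaseCards a b) ≤ 5 → ((sInf (partitionBaseCards a b) : ℕ) : ℝ) ≤
      Real.log ((a * b).factorial) / Real.log (Nat.uniformBell a b) + 5 := by
    intro h
    have h' : ((sInf (partitionBaseCards a b) : ℕ) : ℝ) ≤ 5 := by exact_mod_cast h
    linarith
  rcases hb.eq_or_lt with rfl | hb3
  · rcases ha.eq_or_lt with rfl | ha3
    · exact hsmall (by simp [partitionBaseCards_two_two])
    · exact hsmall ((sInf_partitionBaseCards_two_le ha3).trans (by norm_num))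
  · have hle := sInf_partitionBaseCards_le_clog ha hb3
    rcases le_or_gt (Nat.clog a b) 2 with hk | hk
    · exact hsmall (by omega)
    · obtain ⟨k, hk'⟩ : ∃ k, Nat.clog a b = k + 2 := ⟨Nat.clog a b - 2, by omega⟩
      have hpow : a ^ (k + 1) < b := (Nat.lt_clog_iff_pow_lt (by omega)).1 (by omega)
      have hratio := le_log_factorial_div_log_uniformBell ha hb hpow.le
      have hle' : ((sInf (partitionBaseCards a b) : ℕ) : ℝ) ≤ k + 5 := by
        exact_mod_cast hle.trans (by omega)
      linarith
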